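/- If the hypergraph 𝒜 ⊆ 𝒫_f(I) has the strong intersection property, then the free presheaf V generated by the sets E_i over the field K satisfies condition (G). -/

import Mathlib

universe u v w

/-- The product set `E_α = Π_{i ∈ α} E_i`. -/
def EProd {I : Type u} (E : I → Type w) (α : Finset I) : Type (max u w) :=
  ∀ i : α, E i.1

/-- The projection `π^{βα} : E_α → E_β` for `β ⊆ α`. -/
def resE {I : Type u} (E : I → Type w) {α β : Finset I} (h : β ⊆ α) :
    EProd E α → EProd E β :=
  fun f i => f ⟨i.1, h i.2⟩

/-- The injection `j_{αβ} : V_β → V_α` of the free presheaf, given by precomposition with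
`π^{βα}`; here `V_α = K^{E_α}` is the space of all functions `E_α → K`. -/
def jmap {I : Type u} (E : I → Type w) (K : Type v) [Field K] {α β : Finset I}
    (h : β ⊆ α) : (EProd E β → K) →ₗ[K] (EProd E α → K) where
  toFun g := g ∘ resE E h
  map_add' _ _ := rfl
  map_smul' _ _ := rfl

/-- Condition (G) (the sum-intersection condition) for the free presheaf `V` on the
hypergraph `𝒜 ⊆ 𝒫_f(I)`: for every arrow `α → β` (i.e. `β ⊆ α`) in `𝒜`,
`V_{αβ} ∩ (Σ_{γ∈𝒜 : γ⊆α, γ≠α, ¬β⊆γ} V_{αγ}) ⊆ Σ_{γ'∈𝒜 : γ'⊆α, γ'≠α, γ'⊆β, γ'≠β} V_{αγ'}`. -/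
def FreeConditionG {I : Type u} (A : Set (Finset I)) (E : I → Type w) (K : Type v)
    [Field K] : Prop :=
  ∀ α ∈ A, ∀ β ∈ A, ∀ h : β ⊆ α,
    LinearMap.range (jmap E K h) ⊓
        (⨆ (γ : Finset I) (hγ : γ ∈ A ∧ γ ⊆ α ∧ γ ≠ α ∧ ¬ β ⊆ γ),
          LinearMap.range (jmap E K hγ.2.1))
      ≤ ⨆ (γ : Finset I) (hγ : γ ∈ A ∧ γ ⊆ α ∧ γ ≠ α ∧ γ ⊆ β ∧ γ ≠ β),
          LinearMap.range (jmap E K hγ.2.1)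

/-- Replace the coordinates outside `β` by those of the base point `e`. -/
def freezeOutside {I : Type u} [DecidableEq I] {E : I → Type w} (e : ∀ i, E i)
    (α β : Finset I) : EProd E α → EProd E α :=
  fun x i => if i.1 ∈ β then x i else e i.1

/-- Extend a point of `E_β` to a point of `E_γ` by the base point `e`. -/
def extendBase {I : Type u} [DecidableEq I] {E : I → Type w} (e : ∀ i, E i)
    (β γ : Finset I) : EProd E β → EProd E γ :=
  fun y i => if h : i.1 ∈ β then y ⟨i.1, h⟩ else e i.1

theorem resE_comp_freezeOutside {I : Type u} [DecidableEq I] {E : I → Type w}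
    (e : ∀ i, E i) {α β : Finset I} (h : β ⊆ α) :
    resE E h ∘ freezeOutside e α β = resE E h := by
  funext x i
  exact if_pos i.2

theorem resE_comp_freezeOutside_eq_extendBase {I : Type u} [DecidableEq I] {E : I → Type w}
    (e : ∀ i, E i) {α β γ : Finset I} (h : γ ⊆ α) (h' : β ∩ γ ⊆ α) :
    resE E h ∘ freezeOutside e α β = extendBase e (β ∩ γ) γ ∘ resE E h' := by
  funext x i
  by_cases hβ : i.1 ∈ β <;> simp [resE, freezeOutside, extendBase, hβ]

/-- If the hypergraph `𝒜 ⊆ 𝒫_f(I)` has the strong intersection property,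
then the free presheaf `V` generated by the sets `E_i` over the field `K` satisfies
condition (G). -/
theorem strongIntersection_freeConditionG {I : Type u} [DecidableEq I]
    (A : Set (Finset I)) (E : I → Type w) [∀ i, Nonempty (E i)] (K : Type v) [Field K]
    (hstrong : ∀ α ∈ A, ∀ α' ∈ A, α ∩ α' ∈ A) :
    FreeConditionG A E K := by
  intro α _ β hβ h
  let e : ∀ i, E i := fun i => Classical.arbitrary (E i)
  let T := LinearMap.funLeft K K (freezeOutside e α β)
  rintro _ ⟨⟨g, rfl⟩, hsum⟩
  have hfix : T (jmap E K h g) = jmap E K h g :=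
    congrArg (g ∘ ·) (resE_comp_freezeOutside e h)
  rw [← hfix, ← Submodule.mem_comap]
  refine SetLike.le_def.mp ?_ hsum
  refine iSup₂_le fun γ hγ => ?_
  obtain ⟨hγA, hγα, hne, hβγ⟩ := hγ
  have hsub : β ∩ γ ⊆ α := Finset.inter_subset_right.trans hγα
  rintro _ ⟨f, rfl⟩
  refine Submodule.mem_iSup_of_mem (β ∩ γ) (Submodule.mem_iSup_of_mem
    ⟨hstrong β hβ γ hγA, hsub, fun heq => ?_, Finset.inter_subset_left, fun heq => ?_⟩
    ⟨f ∘ extendBase e (β ∩ γ) γ, ?_⟩)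
  · exact hne (hγα.antisymm (heq ▸ Finset.inter_subset_right))
  · exact hβγ (Finset.inter_eq_left.mp heq)
  · exact congrArg (f ∘ ·) (resE_comp_freezeOutside_eq_extendBase e hγα hsub).symm
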